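/- Fix α > 0 with α ∉ ℤ and let s > 1. There exists a constant C > 0 such that for every m ∈ ℤ: ∫₀^∞ ∫₀^∞ (1+r)^{-2s} |G_{m,0}(r,r')|² (1+r')^{-2s} r r' dr dr' ≤ C |m+α|^{-3}; in other words, the integral operator on L²((0,∞), r dr) with kernel (1+r)^{-s} G_{m,0}(r,r') (1+r')^{-s} is Hilbert–Schmidt with Hilbert–Schmidt norm at most C^{1/2} |m+α|^{-3/2}. -/

import Mathlib

open scoped Real

noncomputable section

/-- The Pochhammer symbol `(a)ₙ = a (a+1) ⋯ (a+n−1)`. -/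
noncomputable def poch (a : ℝ) (n : ℕ) : ℝ := ∏ k ∈ Finset.range n, (a + k)

/-- The Kummer confluent hypergeometric function `M(a,b,z)`. -/
noncomputable def kummerM (a b z : ℝ) : ℝ :=
  ∑' n : ℕ, (poch a n / poch b n) * z ^ n / (n.factorial : ℝ)

/-- Tricomi's confluent hypergeometric function `U(a,b,z)` for `a > 0`, `z > 0`,
via its integral representation. -/
noncomputable def tricomiU (a b z : ℝ) : ℝ :=
  (Real.Gamma a)⁻¹ * ∫ t in Set.Ioi (0:ℝ), Real.exp (-(z*t)) * t ^ (a-1) * (1+t) ^ (b-a-1)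

/-- `v_m(r) = e^{-αr} (2αr)^{|m|} M(1/2+|m|+m, 1+2|m|, 2αr)`. -/
noncomputable def vm (α : ℝ) (m : ℤ) (r : ℝ) : ℝ :=
  Real.exp (-(α*r)) * (2*α*r) ^ (m.natAbs) *
    kummerM (1/2 + (m.natAbs : ℝ) + (m : ℝ)) (1 + 2*(m.natAbs:ℝ)) (2*α*r)

/-- `u_m(r) = e^{-αr} (2αr)^{|m|} U(1/2+|m|+m, 1+2|m|, 2αr)`. -/
noncomputable def um (α : ℝ) (m : ℤ) (r : ℝ) : ℝ :=
  Real.exp (-(α*r)) * (2*α*r) ^ (m.natAbs) *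
    tricomiU (1/2 + (m.natAbs : ℝ) + (m : ℝ)) (1 + 2*(m.natAbs:ℝ)) (2*α*r)

/-- The denominator `a'_m + |m+α| a_m`. -/
noncomputable def denomG (α : ℝ) (m : ℤ) : ℝ := deriv (vm α m) 1 + |(m:ℝ) + α| * vm α m 1

open Classical in
/-- The kernel `G_{m,0}(r,r')` for `r ≤ r'`. -/
noncomputable def Gm0aux (α : ℝ) (m : ℤ) (r r' : ℝ) : ℝ :=
  if r' ≤ 1 then
    (Real.Gamma (1/2 + (m:ℝ) + (m.natAbs:ℝ)) / Real.Gamma (1 + 2*(m.natAbs:ℝ))) * vm α m r *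
      (um α m r' - ((deriv (um α m) 1 + |(m:ℝ) + α| * um α m 1) / denomG α m) * vm α m r')
  else if r ≤ 1 then
    vm α m r * r' ^ (-|(m:ℝ) + α|) / denomG α m
  else
    (1/(2*|(m:ℝ) + α|)) * ((r/r') ^ |(m:ℝ) + α| -
      ((deriv (vm α m) 1 - |(m:ℝ) + α| * vm α m 1) / denomG α m) * (r*r') ^ (-|(m:ℝ) + α|))

open Classical in
/-- The kernel `G_{m,0}(r,r')`, symmetric in its arguments. -/
noncomputable def Gm0 (α : ℝ) (m : ℤ) (r r' : ℝ) : ℝ :=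
  if r ≤ r' then Gm0aux α m r r' else Gm0aux α m r' r

lemma poch_pos {a : ℝ} (ha : 0 < a) (n : ℕ) : 0 < poch a n :=
  Finset.prod_pos fun k _ => by positivity

lemma poch_le_poch {a b : ℝ} (ha : 0 < a) (hab : a ≤ b) (n : ℕ) : poch a n ≤ poch b n :=
  Finset.prod_le_prod (fun k _ => by positivity) fun k _ => by linarith

lemma kummerM_term_le {a b z : ℝ} (ha : 0 < a) (hab : a ≤ b) (hz : 0 ≤ z) (n : ℕ) :
    (poch a n / poch b n) * z ^ n / (n.factorial : ℝ) ≤ z ^ n / (n.factorial : ℝ) := by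
  have h : poch a n / poch b n ≤ 1 :=
    (div_le_one (poch_pos (ha.trans_le hab) n)).2 (poch_le_poch ha hab n)
  gcongr
  exact mul_le_of_le_one_left (by positivity) h

lemma kummerM_term_nonneg {a b z : ℝ} (ha : 0 < a) (hab : a ≤ b) (hz : 0 ≤ z) (n : ℕ) :
    0 ≤ (poch a n / poch b n) * z ^ n / (n.factorial : ℝ) := by
  have h1 := poch_pos ha n
  have h2 := poch_pos (ha.trans_le hab) n
  positivity

lemma summable_kummerM {a b z : ℝ} (ha : 0 < a) (hab : a ≤ b) (hz : 0 ≤ z) :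
    Summable fun n : ℕ => (poch a n / poch b n) * z ^ n / (n.factorial : ℝ) :=
  .of_nonneg_of_le (kummerM_term_nonneg ha hab hz) (kummerM_term_le ha hab hz)
    (Real.summable_pow_div_factorial z)

lemma kummerM_le_exp {a b z : ℝ} (ha : 0 < a) (hab : a ≤ b) (hz : 0 ≤ z) :
    kummerM a b z ≤ Real.exp z := by
  rw [Real.exp_eq_exp_ℝ, NormedSpace.exp_eq_tsum_div]
  exact (summable_kummerM ha hab hz).tsum_le_tsum (kummerM_term_le ha hab hz)
    (Real.summable_pow_div_factorial z)

lemma one_le_kummerM {a b z : ℝ} (ha : 0 < a) (hab : a ≤ b) (hz : 0 ≤ z) :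
    1 ≤ kummerM a b z := by
  have h := (summable_kummerM ha hab hz).le_tsum 0 fun n _ => kummerM_term_nonneg ha hab hz n
  simpa [poch, kummerM] using h

lemma kummerM_mono {a b z w : ℝ} (ha : 0 < a) (hab : a ≤ b) (hz : 0 ≤ z) (hzw : z ≤ w) :
    kummerM a b z ≤ kummerM a b w := by
  refine (summable_kummerM ha hab hz).tsum_le_tsum (fun n => ?_)
    (summable_kummerM ha hab (hz.trans hzw))
  have h1 := poch_pos ha n
  have h2 := poch_pos (ha.trans_le hab) n
  gcongr

lemma kummer_param_pos (m : ℤ) : (0 : ℝ) < 1/2 + (m.natAbs : ℝ) + (m : ℝ) := by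
  rw [Nat.cast_natAbs, Int.cast_abs]
  linarith [neg_abs_le (m : ℝ)]

lemma kummer_param_le (m : ℤ) :
    (1/2 + (m.natAbs : ℝ) + (m : ℝ)) ≤ 1 + 2 * (m.natAbs : ℝ) := by
  rw [Nat.cast_natAbs, Int.cast_abs]
  linarith [le_abs_self (m : ℝ)]

lemma vm_le {α r : ℝ} (hα : 0 < α) (m : ℤ) (hr : 0 < r) (hr1 : r ≤ 1) :
    vm α m r ≤ Real.exp α * (2*α*r) ^ m.natAbs := by
  have hM := kummerM_le_exp (kummer_param_pos m) (kummer_param_le m)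
    (show 0 ≤ 2*α*r by positivity)
  calc vm α m r ≤ Real.exp (-(α*r)) * (2*α*r) ^ m.natAbs * Real.exp (2*α*r) := by
        unfold vm; gcongr
    _ = Real.exp (α*r) * (2*α*r) ^ m.natAbs := by
        rw [mul_right_comm, ← Real.exp_add]; ring_nf
    _ ≤ _ := by gcongr; nlinarith

lemma le_vm {α r : ℝ} (hα : 0 < α) (m : ℤ) (hr : 0 < r) (hr1 : r ≤ 1) :
    Real.exp (-α) * (2*α*r) ^ m.natAbs ≤ vm α m r := by
  have hM := one_le_kummerM (kummer_param_pos m) (kummer_param_le m)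
    (show 0 ≤ 2*α*r by positivity)
  calc Real.exp (-α) * (2*α*r) ^ m.natAbs
      ≤ Real.exp (-(α*r)) * (2*α*r) ^ m.natAbs := by gcongr; nlinarith
    _ ≤ _ := by unfold vm; exact le_mul_of_one_le_right (by positivity) hM

lemma vm_pos {α r : ℝ} (hα : 0 < α) (m : ℤ) (hr : 0 < r) (hr1 : r ≤ 1) : 0 < vm α m r :=
  lt_of_lt_of_le (by positivity) (le_vm hα m hr hr1)

lemma exp_mul_pow_mono {α x y : ℝ} {n : ℕ} (hα : 0 < α) (hx : 0 < x) (hxy : x ≤ y)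
    (hn : α * y ≤ n) :
    Real.exp (-(α*x)) * (2*α*x) ^ n ≤ Real.exp (-(α*y)) * (2*α*y) ^ n := by
  have hy : 0 < y := hx.trans_le hxy
  have hn0 : (0 : ℝ) < n := (mul_pos hα hy).trans_le hn
  set δ : ℝ := α / n * (y - x)
  have hδ : y * (α / n) ≤ 1 := by
    rw [mul_div_assoc', div_le_one hn0]; linarith
  have h1 : x ≤ y * Real.exp (-δ) := by
    have h2 : 1 - δ ≤ Real.exp (-δ) := Real.one_sub_le_exp_neg δ
    have h3 : y * (1 - δ) ≤ y * Real.exp (-δ) := by gcongr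
    have h4 : y * δ ≤ y - x := by
      have := mul_le_mul_of_nonneg_right hδ (sub_nonneg.2 hxy)
      simp only [δ]; linarith
    linarith
  have h5 : (2*α*x) ^ n ≤ (2*α*(y * Real.exp (-δ))) ^ n := by gcongr
  have h6 : (2*α*(y * Real.exp (-δ))) ^ n = (2*α*y) ^ n * Real.exp (-(α*(y-x))) := by
    rw [← mul_assoc, mul_pow, ← Real.exp_nat_mul]
    congr 2
    simp only [δ]; field_simp
  calc Real.exp (-(α*x)) * (2*α*x) ^ n
      ≤ Real.exp (-(α*x)) * ((2*α*y) ^ n * Real.exp (-(α*(y-x)))) := by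
        rw [← h6]; gcongr
    _ = Real.exp (-(α*x) + -(α*(y-x))) * (2*α*y) ^ n := by rw [Real.exp_add]; ring
    _ = Real.exp (-(α*y)) * (2*α*y) ^ n := by ring_nf

lemma deriv_vm_nonneg {α : ℝ} (hα : 0 < α) {m : ℤ} (hm : 2 * α ≤ m.natAbs) :
    0 ≤ deriv (vm α m) 1 := by
  have hmono : MonotoneOn (vm α m) (Set.Ioo 0 2) := by
    intro x hx y hy hxy
    have hx0 := hx.1
    have hy0 := hy.1
    have hM := kummerM_mono (kummer_param_pos m) (kummer_param_le m)
      (show 0 ≤ 2*α*x by positivity) (show 2*α*x ≤ 2*α*y by gcongr)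
    have hM0 := one_le_kummerM (kummer_param_pos m) (kummer_param_le m)
      (show 0 ≤ 2*α*x by positivity)
    have hy2 := hy.2
    have := exp_mul_pow_mono hα hx0 hxy (show α * y ≤ (m.natAbs : ℝ) by nlinarith)
    unfold vm
    gcongr
  have h := hmono.derivWithin_nonneg (x := 1)
  rwa [derivWithin_of_isOpen isOpen_Ioo (by norm_num)] at h

lemma integral_exp_neg_mul_one_add_pow {z : ℝ} (hz : 0 < z) (k : ℕ) :
    MeasureTheory.IntegrableOn (fun t : ℝ => Real.exp (-(z*t)) * (1+t) ^ k) (Set.Ioi 0) ∧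
    ∫ t in Set.Ioi (0:ℝ), Real.exp (-(z*t)) * (1+t) ^ k ≤
      Real.exp z * (k.factorial / z ^ (k+1)) := by
  set f : ℝ → ℝ := (Set.Ioi (0:ℝ)).indicator fun s => s ^ (k:ℝ) * Real.exp (-z * s ^ (1:ℝ))
  have hf : MeasureTheory.Integrable f :=
    (integrableOn_rpow_mul_exp_neg_mul_rpow (by linarith [(Nat.cast_nonneg k : (0:ℝ) ≤ k)])
      one_pos hz).integrable_indicator measurableSet_Ioi
  have hf0 : ∀ s, 0 ≤ f s := fun s => Set.indicator_nonneg (fun s (hs : 0 < s) => by positivity) s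
  have hfi : ∫ s, f s = k.factorial / z ^ (k+1) := by
    rw [MeasureTheory.integral_indicator measurableSet_Ioi]
    have := Real.integral_rpow_mul_exp_neg_mul_Ioi (a := k+1) (r := z) (by positivity) hz
    simp only [add_sub_cancel_right] at this
    simp only [Real.rpow_one, neg_mul, this, Real.Gamma_nat_eq_factorial, one_div]
    rw [show (k:ℝ) + 1 = ((k+1 : ℕ) : ℝ) by push_cast; ring, Real.rpow_natCast, inv_pow]
    ring
  have hshift := hf.comp_add_left 1
  have heq : Set.EqOn (fun t : ℝ => Real.exp (-(z*t)) * (1+t) ^ k)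
      (fun t => Real.exp z * f (1 + t)) (Set.Ioi 0) := by
    intro t ht
    have ht : 0 < t := ht
    have h1 : (1 + t) ∈ Set.Ioi (0:ℝ) := by show 0 < 1 + t; positivity
    simp only [f, Set.indicator_of_mem h1, Real.rpow_natCast, Real.rpow_one]
    rw [mul_left_comm, ← Real.exp_add, mul_comm]
    ring_nf
  refine ⟨((hshift.const_mul _).integrableOn).congr_fun heq.symm measurableSet_Ioi, ?_⟩
  rw [MeasureTheory.setIntegral_congr_fun measurableSet_Ioi heq,
    MeasureTheory.integral_const_mul, ← hfi]
  gcongr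
  calc ∫ t in Set.Ioi (0:ℝ), f (1 + t) ≤ ∫ t, f (1 + t) :=
        MeasureTheory.setIntegral_le_integral hshift (.of_forall fun t => hf0 _)
    _ = ∫ s, f s := MeasureTheory.integral_add_left_eq_self f 1

lemma tricomi_weight_le {a b t : ℝ} (ha : 1/2 ≤ a) (ht : 0 < t) :
    t ^ (a-1) * (1+t) ^ (b-a-1) ≤ t ^ (-(1/2) : ℝ) * (1+t) ^ (b-3/2) := by
  have h1 : t ^ (a-1/2) ≤ (1+t) ^ (a-1/2) :=
    Real.rpow_le_rpow ht.le (by linarith) (by linarith)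
  calc t ^ (a-1) * (1+t) ^ (b-a-1)
      = t ^ (-(1/2) : ℝ) * (t ^ (a-1/2) * (1+t) ^ (b-a-1)) := by
        rw [← mul_assoc, ← Real.rpow_add ht]; ring_nf
    _ ≤ t ^ (-(1/2) : ℝ) * ((1+t) ^ (a-1/2) * (1+t) ^ (b-a-1)) := by gcongr
    _ = _ := by rw [← Real.rpow_add (by positivity)]; ring_nf

lemma mul_tricomi_weight_le {a t : ℝ} {j : ℕ} (ha : 1/2 ≤ a) (ht : 0 < t) :
    t * (t ^ (a-1) * (1+t) ^ ((j+2:ℝ)-a-1)) ≤ (1+t) ^ (j+1) := by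
  have h1 : t ^ (1/2 : ℝ) ≤ (1+t) ^ (1/2 : ℝ) :=
    Real.rpow_le_rpow ht.le (by linarith) (by norm_num)
  calc t * (t ^ (a-1) * (1+t) ^ ((j+2:ℝ)-a-1))
      ≤ t * (t ^ (-(1/2) : ℝ) * (1+t) ^ ((j+2:ℝ)-3/2)) := by
        gcongr t * ?_; exact tricomi_weight_le ha ht
    _ = t ^ (1/2 : ℝ) * (1+t) ^ ((j+2:ℝ)-3/2) := by
        rw [← mul_assoc, ← Real.rpow_one_add' ht.le (by norm_num)]; norm_num
    _ ≤ (1+t) ^ (1/2 : ℝ) * (1+t) ^ ((j+2:ℝ)-3/2) := by gcongr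
    _ = _ := by
        rw [← Real.rpow_add (by positivity), ← Real.rpow_natCast]; push_cast; ring_nf

lemma tricomi_weight_le_add {a t : ℝ} {j : ℕ} (ha : 1/2 ≤ a) (ht : 0 < t) :
    t ^ (a-1) * (1+t) ^ ((j+2:ℝ)-a-1) ≤
      (Set.Ioc (0:ℝ) 1).indicator (fun t => 2 ^ (j+1) * t ^ (-(1/2) : ℝ)) t
        + 2 * (1+t) ^ j := by
  refine (tricomi_weight_le ha ht).trans ?_
  rcases le_or_gt t 1 with h | h
  · rw [Set.indicator_of_mem (show t ∈ Set.Ioc (0:ℝ) 1 from ⟨ht, h⟩), mul_comm]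
    refine le_add_of_le_of_nonneg ?_ (by positivity)
    gcongr
    calc (1+t) ^ ((j+2:ℝ)-3/2) ≤ 2 ^ ((j+2:ℝ)-3/2) :=
          Real.rpow_le_rpow (by positivity) (by linarith)
            (by linarith [(Nat.cast_nonneg j : (0:ℝ) ≤ j)])
      _ ≤ 2 ^ ((j+1 : ℕ) : ℝ) :=
          Real.rpow_le_rpow_of_exponent_le (by norm_num) (by push_cast; linarith)
      _ = 2 ^ (j+1) := Real.rpow_natCast _ _
  · rw [Set.indicator_of_notMem (fun h' => h.not_ge h'.2), zero_add]
    have h1 : (1+t) ^ (1/2:ℝ) ≤ 2 * t ^ (1/2:ℝ) := by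
      calc (1+t) ^ (1/2:ℝ) ≤ (2^2*t) ^ (1/2:ℝ) :=
            Real.rpow_le_rpow (by positivity) (by linarith) (by norm_num)
        _ = 2 * t ^ (1/2:ℝ) := by
            rw [Real.mul_rpow (by norm_num) ht.le, ← Real.sqrt_eq_rpow (2^2),
              Real.sqrt_sq (by norm_num)]
    calc t ^ (-(1/2) : ℝ) * (1+t) ^ ((j+2:ℝ)-3/2)
        = t ^ (-(1/2) : ℝ) * ((1+t) ^ (1/2:ℝ) * (1+t) ^ j) := by
          rw [← Real.rpow_natCast, ← Real.rpow_add (by positivity)]; ring_nf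
      _ ≤ t ^ (-(1/2) : ℝ) * ((2 * t ^ (1/2:ℝ)) * (1+t) ^ j) := by gcongr
      _ = (t ^ (-(1/2) : ℝ) * t ^ (1/2:ℝ)) * (2 * (1+t) ^ j) := by ring
      _ = 2 * (1+t) ^ j := by rw [← Real.rpow_add ht]; norm_num

/-- The integrand of Tricomi's function without the factor `e^{-zt}`. -/
def tricomiWeight (a b t : ℝ) : ℝ := t ^ (a-1) * (1+t) ^ (b-a-1)

lemma measurable_exp_mul_tricomiWeight (a b z : ℝ) :
    Measurable fun t : ℝ => Real.exp (-(z*t)) * tricomiWeight a b t := by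
  unfold tricomiWeight
  fun_prop

lemma tricomiWeight_nonneg {a b t : ℝ} (ht : 0 < t) : 0 ≤ tricomiWeight a b t := by
  unfold tricomiWeight; positivity

lemma integral_tricomiWeight {a z : ℝ} {j : ℕ} (ha : 1/2 ≤ a) (hz : 0 < z) :
    MeasureTheory.IntegrableOn (fun t : ℝ => Real.exp (-(z*t)) * tricomiWeight a (j+2) t)
      (Set.Ioi 0) ∧
    ∫ t in Set.Ioi (0:ℝ), Real.exp (-(z*t)) * tricomiWeight a (j+2) t ≤
      (8 * z * Real.exp (2*z) + 2 * Real.exp z) * (j.factorial / z ^ (j+1)) := by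
  obtain ⟨hE, hEi⟩ := integral_exp_neg_mul_one_add_pow hz j
  have hsing : MeasureTheory.IntegrableOn (fun t : ℝ => 2 ^ (j+1) * t ^ (-(1/2) : ℝ))
      (Set.Ioc 0 1) := by
    refine MeasureTheory.Integrable.const_mul ?_ _
    exact (intervalIntegrable_iff_integrableOn_Ioc_of_le zero_le_one).1
      (intervalIntegral.intervalIntegrable_rpow' (by norm_num))
  have hsingi : ∫ t in Set.Ioi (0:ℝ), (Set.Ioc (0:ℝ) 1).indicator
      (fun t => 2 ^ (j+1) * t ^ (-(1/2) : ℝ)) t = 2 * 2 ^ (j+1) := by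
    rw [MeasureTheory.setIntegral_indicator measurableSet_Ioc,
      Set.inter_eq_right.2 Set.Ioc_subset_Ioi_self, MeasureTheory.integral_const_mul,
      ← intervalIntegral.integral_of_le zero_le_one, integral_rpow (by norm_num)]
    norm_num
    ring
  have hG : MeasureTheory.IntegrableOn (fun t : ℝ => (Set.Ioc (0:ℝ) 1).indicator
      (fun t => 2 ^ (j+1) * t ^ (-(1/2) : ℝ)) t + 2 * (Real.exp (-(z*t)) * (1+t) ^ j))
      (Set.Ioi 0) :=
    (hsing.integrable_indicator measurableSet_Ioc).integrableOn.add (hE.const_mul 2)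
  have hle : ∀ t ∈ Set.Ioi (0:ℝ), Real.exp (-(z*t)) * tricomiWeight a (j+2) t ≤
      (Set.Ioc (0:ℝ) 1).indicator (fun t => 2 ^ (j+1) * t ^ (-(1/2) : ℝ)) t
        + 2 * (Real.exp (-(z*t)) * (1+t) ^ j) := by
    intro t (ht : 0 < t)
    have h1 : Real.exp (-(z*t)) ≤ 1 := Real.exp_le_one_iff.2 (by nlinarith)
    have h2 : 0 ≤ (Set.Ioc (0:ℝ) 1).indicator (fun t => 2 ^ (j+1) * t ^ (-(1/2) : ℝ)) t :=
      Set.indicator_nonneg (fun s (hs : s ∈ Set.Ioc (0:ℝ) 1) => by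
        have := hs.1; positivity) t
    calc _ ≤ Real.exp (-(z*t)) * ((Set.Ioc (0:ℝ) 1).indicator
            (fun t => 2 ^ (j+1) * t ^ (-(1/2) : ℝ)) t + 2 * (1+t) ^ j) := by
          gcongr; exact tricomi_weight_le_add ha ht
      _ ≤ _ := by nlinarith [mul_le_of_le_one_left h2 h1]
  have hint : MeasureTheory.IntegrableOn
      (fun t : ℝ => Real.exp (-(z*t)) * tricomiWeight a (j+2) t) (Set.Ioi 0) := by
    refine MeasureTheory.Integrable.mono' hG
      (measurable_exp_mul_tricomiWeight a _ z).aestronglyMeasurable ?_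
    refine (MeasureTheory.ae_restrict_iff' measurableSet_Ioi).2 (.of_forall fun t ht => ?_)
    rw [Real.norm_of_nonneg (mul_nonneg (Real.exp_pos _).le (tricomiWeight_nonneg ht))]
    exact hle t ht
  refine ⟨hint, (MeasureTheory.setIntegral_mono_on hint hG measurableSet_Ioi hle).trans ?_⟩
  rw [MeasureTheory.integral_add (hsing.integrable_indicator measurableSet_Ioc).integrableOn
    (hE.const_mul 2), hsingi, MeasureTheory.integral_const_mul, add_mul]
  have hfac : (2*z) ^ j ≤ Real.exp (2*z) * j.factorial :=
    (div_le_iff₀ (by positivity)).1 (Real.pow_div_factorial_le_exp (2*z) (by positivity) j)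
  have hpow : 2 * 2 ^ (j+1) ≤ 8 * z * Real.exp (2*z) * (j.factorial / z ^ (j+1)) := by
    rw [mul_div_assoc', le_div_iff₀ (by positivity)]
    calc 2 * 2 ^ (j+1) * z ^ (j+1) = 4 * z * (2*z) ^ j := by rw [mul_pow]; ring
      _ ≤ 4 * z * (Real.exp (2*z) * j.factorial) := by gcongr
      _ ≤ 8 * z * Real.exp (2*z) * j.factorial := by
        have : 0 ≤ z * Real.exp (2*z) * j.factorial := by positivity
        linarith
  linarith

lemma hasDerivAt_integral_tricomiWeight {a z : ℝ} {j : ℕ} (ha : 1/2 ≤ a) (hz : 0 < z) :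
    ∃ D : ℝ, |D| ≤ Real.exp z * ((j+1).factorial / z ^ (j+2)) ∧
      HasDerivAt (fun w => ∫ t in Set.Ioi (0:ℝ), Real.exp (-(w*t)) * tricomiWeight a (j+2) t)
        D z := by
  have hle : ∀ w, ∀ t ∈ Set.Ioi (0:ℝ),
      ‖-t * Real.exp (-(w*t)) * tricomiWeight a (j+2) t‖ ≤
        Real.exp (-(w*t)) * (1+t) ^ (j+1) := by
    intro w t (ht : 0 < t)
    have h0 := tricomiWeight_nonneg (a := a) (b := j+2) ht
    rw [norm_mul, norm_mul, norm_neg, Real.norm_of_nonneg ht.le, Real.norm_of_nonneg h0,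
      Real.norm_of_nonneg (Real.exp_pos _).le, mul_assoc, mul_left_comm]
    gcongr
    exact mul_tricomi_weight_le ha ht
  have hb := (integral_exp_neg_mul_one_add_pow (half_pos hz) (j+1)).1
  have hmeas : ∀ w, MeasureTheory.AEStronglyMeasurable
      (fun t : ℝ => Real.exp (-(w*t)) * tricomiWeight a (j+2) t)
      (MeasureTheory.volume.restrict (Set.Ioi (0:ℝ))) := fun w =>
    (measurable_exp_mul_tricomiWeight a _ w).aestronglyMeasurable
  have hmeas' : MeasureTheory.AEStronglyMeasurable
      (fun t : ℝ => -t * Real.exp (-(z*t)) * tricomiWeight a (j+2) t)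
      (MeasureTheory.volume.restrict (Set.Ioi (0:ℝ))) := by
    simp_rw [mul_assoc]
    exact (measurable_neg.mul (measurable_exp_mul_tricomiWeight a _ z)).aestronglyMeasurable
  obtain ⟨-, hd⟩ := hasDerivAt_integral_of_dominated_loc_of_deriv_le
    (μ := MeasureTheory.volume.restrict (Set.Ioi (0:ℝ)))
    (F := fun w t => Real.exp (-(w*t)) * tricomiWeight a (j+2) t)
    (F' := fun w t => -t * Real.exp (-(w*t)) * tricomiWeight a (j+2) t)
    (Ioi_mem_nhds (half_lt_self hz)) (.of_forall hmeas) (integral_tricomiWeight ha hz).1 hmeas'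
    ((MeasureTheory.ae_restrict_iff' measurableSet_Ioi).2 <| .of_forall
      fun t ht w (hw : z/2 < w) => (hle w t ht).trans (by
        have ht' : 0 < t := ht
        gcongr)) hb
    (.of_forall fun t w _ => by
      have h : HasDerivAt (fun y : ℝ => Real.exp (-(y*t)) * tricomiWeight a (j+2) t)
          (Real.exp (-(w*t)) * -(1*t) * tricomiWeight a (j+2) t) w :=
        (((hasDerivAt_id w).mul_const t).neg.exp).mul_const _
      exact h.congr_deriv (by ring))
  refine ⟨_, ?_, hd⟩
  obtain ⟨hE, hEi⟩ := integral_exp_neg_mul_one_add_pow hz (j+1)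
  refine le_trans ?_ hEi
  exact MeasureTheory.norm_integral_le_of_norm_le hE
    ((MeasureTheory.ae_restrict_iff' measurableSet_Ioi).2 <| .of_forall fun t ht => hle z t ht)

lemma half_le_kummer_param (m : ℤ) : (1/2 : ℝ) ≤ 1/2 + (m.natAbs : ℝ) + (m : ℝ) := by
  rw [Nat.cast_natAbs, Int.cast_abs]
  linarith [neg_abs_le (m : ℝ)]

lemma um_eq {α : ℝ} {m : ℤ} {j : ℕ} (hj : 2 * m.natAbs = j + 1) (r : ℝ) :
    um α m r = Real.exp (-(α*r)) * (2*α*r) ^ m.natAbs *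
      ((Real.Gamma (1/2 + (m.natAbs : ℝ) + (m : ℝ)))⁻¹ * ∫ t in Set.Ioi (0:ℝ),
        Real.exp (-(2*α*r*t)) * tricomiWeight (1/2 + (m.natAbs : ℝ) + (m : ℝ)) (j+2) t) := by
  have hb : 1 + 2 * (m.natAbs : ℝ) = j + 2 := by
    have : (2 * (m.natAbs : ℝ)) = j + 1 := by exact_mod_cast hj
    linarith
  simp only [um, tricomiU, tricomiWeight, hb, mul_assoc]

/-- A constant in the upper bound of `um` on `(0, 1]`. -/
def umConst (α : ℝ) : ℝ := 16 * α * Real.exp (4*α) + 2 * Real.exp (2*α)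

lemma two_exp_le_umConst {α : ℝ} (hα : 0 < α) : 2 * Real.exp (2*α) ≤ umConst α :=
  le_add_of_nonneg_left (by positivity)

lemma two_le_umConst {α : ℝ} (hα : 0 < α) : 2 ≤ umConst α := by
  have : 1 ≤ Real.exp (2*α) := Real.one_le_exp (by positivity)
  linarith [two_exp_le_umConst hα]

lemma um_nonneg {α r : ℝ} (hα : 0 < α) {m : ℤ} {j : ℕ} (hj : 2 * m.natAbs = j + 1)
    (hr : 0 < r) : 0 ≤ um α m r := by
  rw [um_eq hj]
  have hΓ := Real.Gamma_pos_of_pos (kummer_param_pos m)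
  have : 0 ≤ ∫ t in Set.Ioi (0:ℝ), Real.exp (-(2*α*r*t)) *
      tricomiWeight (1/2 + (m.natAbs : ℝ) + (m : ℝ)) (j+2) t :=
    MeasureTheory.setIntegral_nonneg measurableSet_Ioi fun t ht =>
      mul_nonneg (Real.exp_pos _).le (tricomiWeight_nonneg ht)
  positivity

lemma um_le {α r : ℝ} (hα : 0 < α) {m : ℤ} {j : ℕ} (hj : 2 * m.natAbs = j + 1)
    (hr : 0 < r) (hr1 : r ≤ 1) :
    um α m r ≤ (Real.Gamma (1/2 + (m.natAbs : ℝ) + (m : ℝ)))⁻¹ * umConst α *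
      (j.factorial / (2*α*r) ^ m.natAbs) := by
  have hz : 0 < 2*α*r := by positivity
  have hΓ := Real.Gamma_pos_of_pos (kummer_param_pos m)
  have hI := (integral_tricomiWeight (j := j) (half_le_kummer_param m) hz).2
  have hK : 8 * (2*α*r) * Real.exp (2*(2*α*r)) + 2 * Real.exp (2*α*r) ≤ umConst α := by
    have h1 : α * r ≤ α := by nlinarith
    have h2 : Real.exp (2*(2*α*r)) ≤ Real.exp (4*α) := Real.exp_le_exp.2 (by linarith)
    have h3 : Real.exp (2*α*r) ≤ Real.exp (2*α) := Real.exp_le_exp.2 (by linarith)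
    have h4 : 8 * (2*α*r) ≤ 16 * α := by linarith
    unfold umConst
    gcongr
  have he : Real.exp (-(α*r)) ≤ 1 := Real.exp_le_one_iff.2 (by nlinarith)
  rw [um_eq hj]
  calc _ ≤ 1 * (2*α*r) ^ m.natAbs * ((Real.Gamma (1/2 + (m.natAbs : ℝ) + (m : ℝ)))⁻¹ *
        (umConst α * (j.factorial / (2*α*r) ^ (j+1)))) := by
        gcongr
        · exact mul_nonneg (inv_nonneg.2 hΓ.le) <|
            MeasureTheory.setIntegral_nonneg measurableSet_Ioi fun t ht =>
              mul_nonneg (Real.exp_pos _).le (tricomiWeight_nonneg ht)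
        · exact hI.trans (by gcongr)
    _ = _ := by
        rw [← hj, pow_mul', sq]
        field_simp

lemma abs_deriv_um_le {α : ℝ} (hα : 0 < α) {m : ℤ} {j : ℕ} (hj : 2 * m.natAbs = j + 1)
    (hm : α ≤ m.natAbs) :
    |deriv (um α m) 1| ≤ 2 * m.natAbs *
      ((Real.Gamma (1/2 + (m.natAbs : ℝ) + (m : ℝ)))⁻¹ * umConst α *
        (j.factorial / (2*α) ^ m.natAbs)) := by
  have hΓ := Real.Gamma_pos_of_pos (kummer_param_pos m)
  obtain ⟨D, hD, hd⟩ := hasDerivAt_integral_tricomiWeight (j := j) (half_le_kummer_param m)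
    (show 0 < 2*α*1 by positivity)
  have hlin : HasDerivAt (fun r : ℝ => 2*α*r) (2*α) 1 := by
    simpa using (hasDerivAt_id (1:ℝ)).const_mul (2*α)
  have hlin' : HasDerivAt (fun r : ℝ => -(α*r)) (-α) 1 := by
    simpa using (hasDerivAt_id (1:ℝ)).const_mul (-α)
  have hpow : (m.natAbs : ℝ) * (2*α*1) ^ (m.natAbs - 1) * (2*α) =
      m.natAbs * (2*α*1) ^ m.natAbs := by
    obtain ⟨k, hk⟩ : ∃ k, m.natAbs = k + 1 := ⟨m.natAbs - 1, by omega⟩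
    rw [hk, Nat.add_sub_cancel, pow_succ]
    ring
  have hder : deriv (um α m) 1 = (m.natAbs - α) * um α m 1 +
      Real.exp (-(α*1)) * (2*α*1) ^ m.natAbs *
        ((Real.Gamma (1/2 + (m.natAbs : ℝ) + (m : ℝ)))⁻¹ * (D * (2*α))) := by
    rw [funext (um_eq (α := α) hj)]
    refine HasDerivAt.deriv (((hlin'.exp.mul (hlin.pow m.natAbs)).mul
      ((hd.comp (1:ℝ) hlin).const_mul
        (Real.Gamma (1/2 + (m.natAbs : ℝ) + (m : ℝ)))⁻¹)).congr_deriv ?_)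
    simp only [Pi.mul_apply, Pi.pow_apply, Function.comp_apply, hpow]
    ring
  have hub := um_le hα hj one_pos le_rfl
  have hu0 := um_nonneg hα hj one_pos
  have he : Real.exp (-(α*1)) ≤ 1 := Real.exp_le_one_iff.2 (by linarith)
  have hfac : ((j+1).factorial : ℝ) = 2 * m.natAbs * j.factorial := by
    rw [Nat.factorial_succ, ← hj]; push_cast; ring
  simp only [mul_one] at hder hub hD he
  have hE : |Real.exp (-α) * (2*α) ^ m.natAbs *
      ((Real.Gamma (1/2 + (m.natAbs : ℝ) + (m : ℝ)))⁻¹ * (D * (2*α)))| ≤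
      m.natAbs * ((Real.Gamma (1/2 + (m.natAbs : ℝ) + (m : ℝ)))⁻¹ * umConst α *
        (j.factorial / (2*α) ^ m.natAbs)) := by
    rw [abs_mul, abs_mul, abs_mul, abs_mul, abs_of_pos (Real.exp_pos _),
      abs_of_pos (show 0 < (2*α) ^ m.natAbs by positivity), abs_of_pos (inv_pos.2 hΓ),
      abs_of_pos (show 0 < 2*α by positivity)]
    calc _ ≤ 1 * (2*α) ^ m.natAbs * ((Real.Gamma (1/2 + (m.natAbs : ℝ) + (m : ℝ)))⁻¹ *
          (Real.exp (2*α) * ((j+1).factorial / (2*α) ^ (j+2)) * (2*α))) := by gcongr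
      _ = m.natAbs * ((Real.Gamma (1/2 + (m.natAbs : ℝ) + (m : ℝ)))⁻¹ * (2 * Real.exp (2*α)) *
          (j.factorial / (2*α) ^ m.natAbs)) := by
          rw [hfac, pow_succ _ (j+1), ← hj, pow_mul', sq]
          field_simp
      _ ≤ _ := by gcongr; exact two_exp_le_umConst hα
  rw [hder]
  refine (abs_add_le _ _).trans ?_
  rw [abs_of_nonneg (mul_nonneg (sub_nonneg.2 hm) hu0)]
  have : (m.natAbs - α) * um α m 1 ≤ m.natAbs *
      ((Real.Gamma (1/2 + (m.natAbs : ℝ) + (m : ℝ)))⁻¹ * umConst α *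
        (j.factorial / (2*α) ^ m.natAbs)) := by
    gcongr
    linarith
  linarith

lemma le_denomG {α : ℝ} (hα : 0 < α) {m : ℤ} (hm : 2 * α ≤ m.natAbs) :
    |(m:ℝ) + α| * vm α m 1 ≤ denomG α m :=
  le_add_of_nonneg_left (deriv_vm_nonneg hα hm)

lemma abs_natAbs_add_bounds {α : ℝ} (hα : 0 < α) {m : ℤ} (hm : 2 * α ≤ m.natAbs) :
    (m.natAbs : ℝ) / 2 ≤ |(m:ℝ) + α| ∧ |(m:ℝ) + α| ≤ 2 * m.natAbs := by
  have h1 := abs_add_le ((m:ℝ) + α) (-α)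
  have h2 := abs_add_le (m:ℝ) α
  rw [Nat.cast_natAbs, Int.cast_abs] at *
  rw [add_neg_cancel_right, abs_neg] at h1
  rw [abs_of_pos hα] at h1 h2
  constructor <;> linarith [abs_nonneg (m:ℝ)]

/-- The constant in the pointwise bound of `Gm0`. -/
def greenConst (α : ℝ) : ℝ := 6 * umConst α * Real.exp (3*α)

lemma abs_Gm0aux_le_inner {α r r' : ℝ} (hα : 0 < α) {m : ℤ} (hm1 : 1 ≤ m.natAbs)
    (hm : 2 * α ≤ m.natAbs) (hr : 0 < r) (hrr : r ≤ r') (hr' : r' ≤ 1) :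
    |Gm0aux α m r r'| ≤ greenConst α / m.natAbs * (r / r') ^ m.natAbs := by
  obtain ⟨j, hj⟩ : ∃ j, 2 * m.natAbs = j + 1 := ⟨2 * m.natAbs - 1, by omega⟩
  have hr'0 : 0 < r' := hr.trans_le hrr
  have hr1 : r ≤ 1 := hrr.trans hr'
  have hn : (0:ℝ) < m.natAbs := by exact_mod_cast hm1
  obtain ⟨hν, hν'⟩ := abs_natAbs_add_bounds hα hm
  have hd := le_denomG hα hm
  have hΓ := Real.Gamma_pos_of_pos (kummer_param_pos m)
  have hK := two_le_umConst hα
  have hv := vm_le hα m hr hr1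
  have hv0 := vm_pos hα m hr hr1
  have hv' := vm_le hα m hr'0 hr'
  have hv'0 := vm_pos hα m hr'0 hr'
  have hv1 := le_vm hα m one_pos le_rfl
  have hu := um_le hα hj hr'0 hr'
  have hu0 := um_nonneg hα hj hr'0
  have hb := um_le hα hj one_pos le_rfl
  have hb0 := um_nonneg hα hj one_pos
  have hb' := abs_deriv_um_le hα hj (by linarith)
  have hΓ2 : Real.Gamma (1 + 2 * (m.natAbs : ℝ)) = 2 * m.natAbs * j.factorial := by
    have h1 : 1 + 2 * (m.natAbs : ℝ) = ((2 * m.natAbs : ℕ) : ℝ) + 1 := by push_cast; ring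
    rw [h1, Real.Gamma_nat_eq_factorial, hj, Nat.factorial_succ, ← hj]
    push_cast
    ring
  have hcomm : 1/2 + (m:ℝ) + (m.natAbs:ℝ) = 1/2 + (m.natAbs : ℝ) + (m : ℝ) := by ring
  rw [Gm0aux, if_pos hr', hcomm, hΓ2]
  set n := m.natAbs
  set ν := |(m:ℝ) + α|
  set Γ := Real.Gamma (1/2 + (n : ℝ) + (m : ℝ))
  set K := umConst α
  set κ := (deriv (um α m) 1 + ν * um α m 1) / denomG α m
  simp only [mul_one] at hv1 hb
  have hj0 : (0:ℝ) < j.factorial := by positivity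
  have hκ : |κ| ≤ 8 * Real.exp α * K * (Γ⁻¹ * (j.factorial / ((2*α)^n * (2*α) ^ n))) := by
    have hnum : |deriv (um α m) 1 + ν * um α m 1| ≤
        4 * n * (Γ⁻¹ * K * (j.factorial / (2*α) ^ n)) := by
      refine (abs_add_le _ _).trans ?_
      rw [abs_of_nonneg (show 0 ≤ ν * um α m 1 by positivity)]
      have : ν * um α m 1 ≤ (2 * n) * (Γ⁻¹ * K * (j.factorial / (2*α) ^ n)) := by gcongr
      linarith
    have hden : n / 2 * (Real.exp (-α) * (2*α) ^ n) ≤ denomG α m :=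
      (mul_le_mul hν hv1 (by positivity) (by positivity)).trans hd
    have hden0 : 0 < n / 2 * (Real.exp (-α) * (2*α) ^ n) := by positivity
    rw [abs_div, abs_of_pos (hden0.trans_le hden)]
    calc _ ≤ 4 * n * (Γ⁻¹ * K * (j.factorial / (2*α) ^ n)) /
          (n / 2 * (Real.exp (-α) * (2*α) ^ n)) := by gcongr
      _ = _ := by rw [Real.exp_neg]; field_simp; ring
  have h1 : Γ / (2 * n * j.factorial) * (vm α m r * um α m r') ≤
      Real.exp α * K / (2 * n) * (r / r') ^ n := by
    calc _ ≤ Γ / (2 * n * j.factorial) * ((Real.exp α * (2*α*r) ^ n) *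
          (Γ⁻¹ * K * (j.factorial / (2*α*r') ^ n))) := by gcongr
      _ = _ := by rw [mul_pow, mul_pow _ r', div_pow]; field_simp
  have h2 : Γ / (2 * n * j.factorial) * (vm α m r * (|κ| * vm α m r')) ≤
      4 * Real.exp (3*α) * K / n * (r / r') ^ n := by
    calc _ ≤ Γ / (2 * n * j.factorial) * ((Real.exp α * (2*α*r) ^ n) *
          ((8 * Real.exp α * K * (Γ⁻¹ * (j.factorial / ((2*α)^n * (2*α) ^ n)))) *
            (Real.exp α * (2*α*r') ^ n))) := by gcongr
      _ = 4 * (Real.exp α * Real.exp α * Real.exp α) * K / n * (r * r') ^ n := by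
          rw [mul_pow _ r, mul_pow _ r', mul_pow r]; field_simp; ring
      _ = 4 * Real.exp (3*α) * K / n * (r * r') ^ n := by
          rw [← Real.exp_add, ← Real.exp_add]; ring_nf
      _ ≤ _ := by
          gcongr
          rw [le_div_iff₀ hr'0]
          nlinarith [mul_pos hr hr'0]
  have h3 : Real.exp α ≤ Real.exp (3*α) := Real.exp_le_exp.2 (by linarith)
  calc _ ≤ Γ / (2 * n * j.factorial) * (vm α m r * um α m r') +
        Γ / (2 * n * j.factorial) * (vm α m r * (|κ| * vm α m r')) := by
        rw [mul_assoc, ← mul_add, ← mul_add, abs_mul, abs_mul, abs_of_pos hv0,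
          abs_of_pos (show 0 < Γ / (2 * n * j.factorial) by positivity)]
        gcongr
        refine (abs_sub _ _).trans ?_
        rw [abs_mul, abs_of_nonneg hu0, abs_of_pos hv'0]
    _ ≤ Real.exp (3*α) * K / (2 * n) * (r / r') ^ n +
        4 * Real.exp (3*α) * K / n * (r / r') ^ n := by
        refine add_le_add (h1.trans ?_) h2
        gcongr
    _ = 9/2 * K * Real.exp (3*α) / n * (r / r') ^ n := by field_simp; ring
    _ ≤ _ := by
        unfold greenConst
        gcongr
        norm_num

lemma two_le_greenConst {α : ℝ} (hα : 0 < α) : 2 ≤ greenConst α := by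
  have h1 : 1 ≤ Real.exp (3*α) := Real.one_le_exp (by positivity)
  have h2 := two_le_umConst hα
  unfold greenConst
  nlinarith

lemma two_mul_exp_le_greenConst {α : ℝ} (hα : 0 < α) :
    2 * (Real.exp α / Real.exp (-α)) ≤ greenConst α := by
  have h1 : Real.exp (2*α) ≤ Real.exp (3*α) := Real.exp_le_exp.2 (by linarith)
  have h2 := two_le_umConst hα
  rw [← Real.exp_sub, show α - -α = 2*α by ring]
  unfold greenConst
  nlinarith [Real.exp_pos (3*α)]

lemma abs_Gm0aux_le {α r r' : ℝ} (hα : 0 < α) {m : ℤ} (hm1 : 1 ≤ m.natAbs)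
    (hm : 2 * α ≤ m.natAbs) (hr : 0 < r) (hrr : r ≤ r') :
    |Gm0aux α m r r'| ≤ greenConst α / m.natAbs * (r / r') ^ ((m.natAbs : ℝ) / 2) := by
  have hr'0 : 0 < r' := hr.trans_le hrr
  have hn : (0:ℝ) < m.natAbs := by exact_mod_cast hm1
  have hB := two_le_greenConst hα
  have hq : r / r' ≤ 1 := (div_le_one hr'0).2 hrr
  have hq0 : 0 < r / r' := by positivity
  obtain ⟨hν, hν'⟩ := abs_natAbs_add_bounds hα hm
  rcases le_or_gt r' 1 with h' | h'
  · refine (abs_Gm0aux_le_inner hα hm1 hm hr hrr h').trans ?_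
    rw [← Real.rpow_natCast]
    gcongr ?_ * ?_
    exact Real.rpow_le_rpow_of_exponent_ge hq0 hq (by linarith)
  have hd := le_denomG hα hm
  have hv1 := le_vm hα m one_pos le_rfl
  have hv10 := vm_pos hα m one_pos le_rfl
  have hdv := deriv_vm_nonneg hα hm
  rw [Gm0aux, if_neg h'.not_ge]
  set n := m.natAbs
  set ν := |(m:ℝ) + α|
  have hν0 : 0 < ν := lt_of_lt_of_le (by positivity) hν
  have hd0 : 0 < denomG α m := lt_of_lt_of_le (by positivity) hd
  split_ifs with h
  · have hv := vm_le hα m hr h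
    have hv0 := vm_pos hα m hr h
    simp only [mul_one] at hv1
    have hden : n / 2 * (Real.exp (-α) * (2*α) ^ n) ≤ denomG α m :=
      (mul_le_mul hν hv1 (by positivity) (by positivity)).trans hd
    rw [abs_of_nonneg (by positivity)]
    have h1 : r ^ n ≤ r ^ ((n:ℝ) / 2) := by
      rw [← Real.rpow_natCast]
      exact Real.rpow_le_rpow_of_exponent_ge hr h (by linarith)
    have h2 : r' ^ (-ν) ≤ (r' ^ ((n:ℝ) / 2))⁻¹ := by
      rw [← Real.rpow_neg hr'0.le]
      exact Real.rpow_le_rpow_of_exponent_le h'.le (by linarith)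
    calc _ ≤ (Real.exp α * (2*α*r) ^ n) * r' ^ (-ν) /
          (n / 2 * (Real.exp (-α) * (2*α) ^ n)) := by gcongr
      _ = 2 * (Real.exp α / Real.exp (-α)) / n * (r ^ n * r' ^ (-ν)) := by
          rw [mul_pow _ r]; field_simp
      _ ≤ greenConst α / n * (r ^ ((n:ℝ) / 2) * (r' ^ ((n:ℝ) / 2))⁻¹) := by
          gcongr
          exact two_mul_exp_le_greenConst hα
      _ = _ := by rw [Real.div_rpow hr.le hr'0.le, div_eq_mul_inv (r ^ _)]
  · push Not at h
    have hquot : |(deriv (vm α m) 1 - ν * vm α m 1) / denomG α m| ≤ 1 := by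
      rw [abs_div, abs_of_pos hd0, div_le_one hd0, abs_le]
      have : 0 ≤ ν * vm α m 1 := by positivity
      constructor <;> simp only [denomG] <;> linarith
    have h1 : (r * r') ^ (-ν) ≤ (r / r') ^ ν := by
      rw [Real.rpow_neg (by positivity), ← Real.inv_rpow (by positivity)]
      refine Real.rpow_le_rpow (by positivity) ?_ hν0.le
      rw [inv_eq_one_div, div_le_div_iff₀ (by positivity) hr'0]
      have hrsq : 1 ≤ r * r := one_le_mul_of_one_le_of_one_le h.le h.le
      nlinarith [mul_le_mul_of_nonneg_right hrsq hr'0.le]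
    have h2 := Real.rpow_le_rpow_of_exponent_ge hq0 hq hν
    rw [abs_mul, abs_of_pos (by positivity : 0 < 1 / (2 * ν))]
    calc _ ≤ 1 / (2*ν) * ((r / r') ^ ν + 1 * (r / r') ^ ν) := by
          gcongr
          refine (abs_sub _ _).trans ?_
          rw [abs_mul, abs_of_nonneg (by positivity : 0 ≤ (r / r') ^ ν),
            abs_of_nonneg (by positivity : 0 ≤ (r * r') ^ (-ν))]
          gcongr
      _ = 1 / ν * (r / r') ^ ν := by field_simp; ring
      _ ≤ 1 / (n / 2) * (r / r') ^ ((n:ℝ) / 2) := by gcongr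
      _ = 2 / n * (r / r') ^ ((n:ℝ) / 2) := by field_simp
      _ ≤ _ := by gcongr

lemma sq_Gm0aux_le {α r r' : ℝ} (hα : 0 < α) {m : ℤ} (hm1 : 1 ≤ m.natAbs)
    (hm : 2 * α ≤ m.natAbs) (hr : 0 < r) (hrr : r ≤ r') :
    Gm0aux α m r r' ^ 2 ≤ (greenConst α / m.natAbs) ^ 2 * (r / r') ^ m.natAbs := by
  have hr'0 : 0 < r' := hr.trans_le hrr
  calc _ ≤ (greenConst α / m.natAbs * (r / r') ^ ((m.natAbs : ℝ) / 2)) ^ 2 :=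
        sq_le_sq' (neg_le_of_abs_le (abs_Gm0aux_le hα hm1 hm hr hrr))
          (le_of_abs_le (abs_Gm0aux_le hα hm1 hm hr hrr))
    _ = _ := by
        rw [mul_pow, ← Real.rpow_mul_natCast (by positivity), Nat.cast_ofNat,
          div_mul_cancel₀ _ two_ne_zero, Real.rpow_natCast]

/-- The scale-invariant kernel `t⁻¹ (min r t / max r t)ⁿ`. -/
def ratioKernel (n : ℕ) (r t : ℝ) : ℝ := if t ≤ r then (t / r) ^ n / t else (r / t) ^ n / t

lemma integral_ratioKernel {n : ℕ} (hn : 1 ≤ n) {r : ℝ} (hr : 0 < r) :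
    MeasureTheory.IntegrableOn (ratioKernel n r) (Set.Ioi 0) ∧
      ∫ t in Set.Ioi (0:ℝ), ratioKernel n r t = 2 / n := by
  have hn0 : (0:ℝ) < n := by exact_mod_cast hn
  have e1 : Set.EqOn (fun t => (r ^ n)⁻¹ * t ^ ((n:ℝ) - 1)) (ratioKernel n r) (Set.Ioc 0 r) := by
    intro t ht
    have ht0 := ht.1
    simp only [ratioKernel, if_pos ht.2]
    rw [Real.rpow_sub_one ht0.ne', Real.rpow_natCast, div_pow]
    field_simp
  have e2 : Set.EqOn (fun t => r ^ n * t ^ (-(n:ℝ) - 1)) (ratioKernel n r) (Set.Ioi r) := by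
    intro t (ht : r < t)
    have ht0 := hr.trans ht
    simp only [ratioKernel, if_neg ht.not_ge]
    rw [Real.rpow_sub_one ht0.ne', Real.rpow_neg ht0.le, Real.rpow_natCast, div_pow]
    field_simp
  have i1 : MeasureTheory.IntegrableOn (fun t : ℝ => t ^ ((n:ℝ) - 1)) (Set.Ioc 0 r) :=
    (intervalIntegrable_iff_integrableOn_Ioc_of_le hr.le).1
      (intervalIntegral.intervalIntegrable_rpow' (by linarith))
  have i2 : MeasureTheory.IntegrableOn (fun t : ℝ => t ^ (-(n:ℝ) - 1)) (Set.Ioi r) :=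
    integrableOn_Ioi_rpow_of_lt (by linarith) hr
  have j1 : MeasureTheory.IntegrableOn (ratioKernel n r) (Set.Ioc 0 r) :=
    MeasureTheory.IntegrableOn.congr_fun (i1.const_mul (r ^ n)⁻¹) e1 measurableSet_Ioc
  have j2 : MeasureTheory.IntegrableOn (ratioKernel n r) (Set.Ioi r) :=
    MeasureTheory.IntegrableOn.congr_fun (i2.const_mul (r ^ n)) e2 measurableSet_Ioi
  rw [← Set.Ioc_union_Ioi_eq_Ioi hr.le]
  refine ⟨j1.union j2, ?_⟩
  rw [MeasureTheory.setIntegral_union Set.Ioc_disjoint_Ioi_same measurableSet_Ioi j1 j2,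
    ← MeasureTheory.setIntegral_congr_fun measurableSet_Ioc e1,
    ← MeasureTheory.setIntegral_congr_fun measurableSet_Ioi e2,
    MeasureTheory.integral_const_mul, MeasureTheory.integral_const_mul,
    ← intervalIntegral.integral_of_le hr.le, integral_rpow (.inl (by linarith)),
    integral_Ioi_rpow_of_lt (by linarith) hr]
  simp only [sub_add_cancel]
  rw [Real.rpow_neg hr.le, Real.rpow_natCast, Real.zero_rpow hn0.ne']
  field_simp
  ring

lemma sq_Gm0_le {α r t : ℝ} (hα : 0 < α) {m : ℤ} (hm1 : 1 ≤ m.natAbs)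
    (hm : 2 * α ≤ m.natAbs) (hr : 0 < r) (ht : 0 < t) :
    Gm0 α m r t ^ 2 ≤ (greenConst α / m.natAbs) ^ 2 * (t * ratioKernel m.natAbs r t) := by
  have key : ∀ x : ℝ, t * (x / t) = x := fun x => mul_div_cancel₀ x ht.ne'
  rcases lt_trichotomy r t with h | rfl | h
  · simp only [Gm0, ratioKernel, if_pos h.le, if_neg h.not_ge, key]
    exact sq_Gm0aux_le hα hm1 hm hr h.le
  · simp only [Gm0, ratioKernel, le_refl, if_true, key]
    exact sq_Gm0aux_le hα hm1 hm hr le_rfl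
  · simp only [Gm0, ratioKernel, if_neg h.not_ge, if_pos h.le, key]
    exact sq_Gm0aux_le hα hm1 hm ht h.le

lemma integrableOn_weight {s : ℝ} (hs : 1 < s) :
    MeasureTheory.IntegrableOn (fun r : ℝ => (1+r) ^ (-(2*s)) * r) (Set.Ioi 0) := by
  have h := (integrable_one_add_norm (E := ℝ) (μ := MeasureTheory.volume) (r := 2*s-1)
    (by simp; linarith)).integrableOn (s := Set.Ioi 0)
  refine h.mono' (by fun_prop) ?_
  refine (MeasureTheory.ae_restrict_iff' measurableSet_Ioi).2 (.of_forall fun r hr => ?_)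
  have hr : 0 < r := hr
  rw [Real.norm_of_nonneg hr.le, Real.norm_of_nonneg (by positivity)]
  calc (1+r) ^ (-(2*s)) * r ≤ (1+r) ^ (-(2*s)) * (1+r) := by gcongr; linarith
    _ = (1+r) ^ (-(2*s-1)) := by
        rw [← Real.rpow_add_one (by positivity)]; ring_nf

lemma weight_mul_sq_le_one {s t : ℝ} (hs : 1 < s) (ht : 0 < t) :
    (1+t) ^ (-(2*s)) * t * t ≤ 1 := by
  calc (1+t) ^ (-(2*s)) * t * t ≤ (1+t) ^ (-2 : ℝ) * t * t := by
        gcongr 1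
        gcongr ?_ * t
        exact Real.rpow_le_rpow_of_exponent_le (by linarith) (by linarith)
    _ = t ^ 2 / (1+t) ^ 2 := by
        rw [Real.rpow_neg (by positivity), Real.rpow_ofNat]; ring
    _ ≤ 1 := by
        rw [div_le_one (by positivity)]
        gcongr
        linarith

lemma integral_Gm0_le {α s : ℝ} (hα : 0 < α) (hs : 1 < s) {m : ℤ} (hm1 : 1 ≤ m.natAbs)
    (hm : 2 * α ≤ m.natAbs) :
    (∫ r in Set.Ioi (0:ℝ), ∫ r' in Set.Ioi (0:ℝ),
      (1+r) ^ (-(2*s)) * (Gm0 α m r r')^2 * (1+r') ^ (-(2*s)) * r * r') ≤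
    (2 * greenConst α ^ 2 * ∫ r in Set.Ioi (0:ℝ), (1+r) ^ (-(2*s)) * r) /
      (m.natAbs : ℝ) ^ 3 := by
  have hn : (0:ℝ) < m.natAbs := by exact_mod_cast hm1
  have inner : ∀ r ∈ Set.Ioi (0:ℝ), ∫ r' in Set.Ioi (0:ℝ),
      (1+r) ^ (-(2*s)) * (Gm0 α m r r')^2 * (1+r') ^ (-(2*s)) * r * r' ≤
      2 * greenConst α ^ 2 / (m.natAbs : ℝ) ^ 3 * ((1+r) ^ (-(2*s)) * r) := by
    intro r (hr : 0 < r)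
    obtain ⟨hi, he⟩ := integral_ratioKernel hm1 hr
    calc _ ≤ ∫ t in Set.Ioi (0:ℝ), ((greenConst α / m.natAbs) ^ 2 * ((1+r) ^ (-(2*s)) * r)) *
          ratioKernel m.natAbs r t := by
          refine MeasureTheory.integral_mono_of_nonneg ?_ (hi.const_mul _) ?_
          · refine (MeasureTheory.ae_restrict_iff' measurableSet_Ioi).2
              (.of_forall fun t ht => ?_)
            have ht : 0 < t := ht
            simp only [Pi.zero_apply]
            positivity
          · refine (MeasureTheory.ae_restrict_iff' measurableSet_Ioi).2
              (.of_forall fun t ht => ?_)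
            have ht : 0 < t := ht
            have hG := sq_Gm0_le hα hm1 hm hr ht
            have hw := weight_mul_sq_le_one hs ht
            have hk : 0 ≤ ratioKernel m.natAbs r t := by
              unfold ratioKernel; split_ifs <;> positivity
            beta_reduce
            calc _ ≤ (1+r) ^ (-(2*s)) * ((greenConst α / m.natAbs) ^ 2 *
                    (t * ratioKernel m.natAbs r t)) * (1+t) ^ (-(2*s)) * r * t := by gcongr
              _ = (greenConst α / m.natAbs) ^ 2 * ((1+r) ^ (-(2*s)) * r) *
                    ratioKernel m.natAbs r t * ((1+t) ^ (-(2*s)) * t * t) := by ring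
              _ ≤ _ := mul_le_of_le_one_right (by positivity) hw
      _ = _ := by
          rw [MeasureTheory.integral_const_mul, he]
          field_simp
  calc _ ≤ ∫ r in Set.Ioi (0:ℝ),
        2 * greenConst α ^ 2 / (m.natAbs : ℝ) ^ 3 * ((1+r) ^ (-(2*s)) * r) := by
        refine MeasureTheory.integral_mono_of_nonneg ?_ ((integrableOn_weight hs).const_mul _)
          ((MeasureTheory.ae_restrict_iff' measurableSet_Ioi).2 (.of_forall inner))
        refine (MeasureTheory.ae_restrict_iff' measurableSet_Ioi).2 (.of_forall fun r hr => ?_)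
        have hr : 0 < r := hr
        refine MeasureTheory.setIntegral_nonneg measurableSet_Ioi fun t ht => ?_
        have ht : 0 < t := ht
        positivity
    _ = _ := by
        rw [MeasureTheory.integral_const_mul]
        ring

theorem stmt19 (α : ℝ) (hα : 0 < α) (hαZ : ∀ n : ℤ, α ≠ (n:ℝ)) (s : ℝ) (hs : 1 < s) :
    ∃ C : ℝ, 0 < C ∧ ∀ m : ℤ,
      (∫ r in Set.Ioi (0:ℝ), ∫ r' in Set.Ioi (0:ℝ),
          (1+r) ^ (-(2*s)) * (Gm0 α m r r')^2 * (1+r') ^ (-(2*s)) * r * r') ≤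
        C * |(m:ℝ) + α| ^ (-(3:ℝ)) := by
  set L : ℤ → ℝ := fun m => ∫ r in Set.Ioi (0:ℝ), ∫ r' in Set.Ioi (0:ℝ),
    (1+r) ^ (-(2*s)) * (Gm0 α m r r')^2 * (1+r') ^ (-(2*s)) * r * r'
  set A : ℝ := ∫ r in Set.Ioi (0:ℝ), (1+r) ^ (-(2*s)) * r
  have hA : 0 ≤ A := MeasureTheory.setIntegral_nonneg measurableSet_Ioi fun r (hr : 0 < r) => by
    positivity
  set N : ℕ := ⌈2 * α⌉₊ + 1
  set S : ℝ := ∑ k ∈ Finset.Icc (-(N:ℤ)) N, |L k| * |(k:ℝ) + α| ^ 3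
  have hS : 0 ≤ S := Finset.sum_nonneg fun k _ => by positivity
  refine ⟨16 * greenConst α ^ 2 * A + S + 1, by positivity, fun m => ?_⟩
  change L m ≤ _
  have hν : 0 < |(m:ℝ) + α| := abs_pos.2 fun h => hαZ (-m) (by push_cast; linarith)
  rw [Real.rpow_neg hν.le, Real.rpow_ofNat, ← div_eq_mul_inv, le_div_iff₀ (by positivity)]
  by_cases hmN : m ∈ Finset.Icc (-(N:ℤ)) N
  · have h1 : |L m| * |(m:ℝ) + α| ^ 3 ≤ S :=
      Finset.single_le_sum (f := fun k : ℤ => |L k| * |(k:ℝ) + α| ^ 3)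
        (fun k _ => by positivity) hmN
    have h2 : L m * |(m:ℝ) + α| ^ 3 ≤ |L m| * |(m:ℝ) + α| ^ 3 := by
      gcongr; exact le_abs_self _
    have h3 : 0 ≤ 16 * greenConst α ^ 2 * A := by positivity
    linarith
  · rw [Finset.mem_Icc] at hmN
    have hN : N ≤ m.natAbs := by omega
    have hm1 : 1 ≤ m.natAbs := le_trans (Nat.le_add_left _ _) hN
    have hm : 2 * α ≤ m.natAbs := by
      have h1 : ((⌈2 * α⌉₊ : ℕ) : ℝ) ≤ m.natAbs := by
        exact_mod_cast (Nat.le_succ _).trans hN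
      exact (Nat.le_ceil _).trans h1
    have hn : (0:ℝ) < m.natAbs := by exact_mod_cast hm1
    have hν2 := (abs_natAbs_add_bounds hα hm).2
    calc L m * |(m:ℝ) + α| ^ 3
        ≤ (2 * greenConst α ^ 2 * A) / (m.natAbs : ℝ) ^ 3 * (2 * m.natAbs) ^ 3 := by
          gcongr
          exact integral_Gm0_le hα hs hm1 hm
      _ = 16 * greenConst α ^ 2 * A := by field_simp; ring
      _ ≤ _ := by linarith
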